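/- arXiv:2302.01781 — 4 statements merged into one kernel-verified Lean document; each statement's English description precedes it below -/
import Mathlib

section
/- Let n ≥ 1 and let h_1,…,h_{n-1} : ℝ^n → ℝ be twice continuously differentiable functions of the variables t_1,…,t_n. For each i ∈ {1,…,n} let J_i : ℝ^n → ℝ denote the Jacobian determinant ∂(h_1,…,h_{n-1}, t_i)/∂(t_1,…,t_n), i.e. the determinant of the n×n matrix whose p-th row (for 1 ≤ p ≤ n−1) is the gradient (∂h_p/∂t_1, …, ∂h_p/∂t_n) and whose n-th row is the i-th standard basis vector. Then Σ_{i=1}^{n} ∂J_i/∂t_i = 0 identically on ℝ^n. -/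
/-- The derivative of a determinant is the sum over the rows of the determinants obtained by
differentiating a single row. -/
theorem Matrix.fderiv_det_apply {ι E : Type*} [Fintype ι] [DecidableEq ι]
    [NormedAddCommGroup E] [NormedSpace ℝ E] {A : ι → E → ι → ℝ} {A' : ι → E →L[ℝ] ι → ℝ} {x : E}
    (hA : ∀ p, HasFDerivAt (A p) (A' p) x) (v : E) :
    fderiv ℝ (fun s => Matrix.det (Matrix.of fun p => A p s)) x v =
      ∑ p, Matrix.det ((Matrix.of fun p => A p x).updateRow p (A' p v)) := by
  let f : ContinuousMultilinearMap ℝ (fun _ : ι => ι → ℝ) ℝ :=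
    { (Matrix.detRowAlternating (R := ℝ) (n := ι)).toMultilinearMap with
      cont := Continuous.matrix_det (A := fun M : Matrix ι ι ℝ => M) continuous_id }
  have hf := HasFDerivAt.multilinear_comp f hA
  have h_det : (fun s => Matrix.det (Matrix.of fun p => A p s)) = fun s => f fun p => A p s := rfl
  rw [h_det, hf.fderiv, _root_.sum_apply]
  rfl

/-- Contracting two rows of a determinant with a symmetric matrix gives zero. -/
theorem Matrix.sum_det_updateRow_single_updateRow_eq_zero {ι : Type*} [Fintype ι] [DecidableEq ι]
    (A : Matrix ι ι ℝ) {r l : ι} (hrl : r ≠ l) (H : ι → ι → ℝ) (hH : ∀ i j, H i j = H j i) :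
    ∑ i, ((A.updateRow l (Pi.single i 1)).updateRow r (H i)).det = 0 := by
  set B : ι → ι → ℝ := fun i q =>
    ((A.updateRow l (Pi.single i 1)).updateRow r (Pi.single q 1)).det with hB
  have h_expand (i : ι) :
      ((A.updateRow l (Pi.single i 1)).updateRow r (H i)).det = ∑ q, H i q * B i q := by
    simp only [hB, ← Matrix.cramer_transpose_apply]
    conv_lhs => rw [pi_eq_sum_univ' (H i)]
    simp [map_sum, map_smul, Finset.sum_apply]
  have h_swap (i q : ι) : B i q = - B q i := by
    have h_perm := Matrix.det_permute (Equiv.swap r l)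
      ((A.updateRow l (Pi.single q 1)).updateRow r (Pi.single i 1))
    have h_rows : ((A.updateRow l (Pi.single q 1)).updateRow r (Pi.single i 1)).submatrix
        (Equiv.swap r l) id = (A.updateRow l (Pi.single i 1)).updateRow r (Pi.single q 1) := by
      ext a b
      by_cases har : a = r
      · subst har
        simp [Matrix.updateRow_apply, hrl.symm]
      · by_cases hal : a = l
        · subst hal
          simp [Matrix.updateRow_apply, hrl.symm]
        · simp [Matrix.updateRow_apply, Equiv.swap_apply_of_ne_of_ne har hal, har, hal]
    rw [h_rows, Equiv.Perm.sign_swap hrl] at h_perm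
    simpa [hB] using h_perm
  have h_neg : ∑ i, ∑ q, H i q * B i q = -∑ i, ∑ q, H i q * B i q := by
    conv_lhs => rw [Finset.sum_comm]
    simp only [← Finset.sum_neg_distrib]
    refine Finset.sum_congr rfl fun i _ => Finset.sum_congr rfl fun q _ => ?_
    rw [hH q i, h_swap q i, mul_neg]
  simp only [h_expand]
  linarith

/-- let `h₁,…,h_{n-1} : ℝⁿ → ℝ` be C² functions and for each `i` let
`Jᵢ` be the Jacobian determinant `∂(h₁,…,h_{n-1},tᵢ)/∂(t₁,…,tₙ)`, i.e. the determinant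
of the matrix whose first `n-1` rows are the gradients of the `h_p` and whose last row
is the `i`-th standard basis vector.  Then `Σᵢ ∂Jᵢ/∂tᵢ = 0` identically. -/
theorem sum_pderiv_jacobian_eq_zero
    (n : ℕ) (hn : 1 ≤ n) (h : Fin (n - 1) → (Fin n → ℝ) → ℝ)
    (hh : ∀ p, ContDiff ℝ 2 (h p)) (t : Fin n → ℝ) :
    ∑ i : Fin n,
      fderiv ℝ
        (fun s : Fin n → ℝ =>
          Matrix.det
            (Matrix.of fun p q : Fin n =>
              if hp : (p : ℕ) < n - 1 then fderiv ℝ (h ⟨p, hp⟩) s (Pi.single q 1)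
              else if q = i then (1 : ℝ) else 0))
        t (Pi.single i 1) = 0 := by
  let l : Fin n := ⟨n - 1, by omega⟩
  let H (p : Fin n) (i q : Fin n) : ℝ :=
    if hp : (p : ℕ) < n - 1 then
      fderiv ℝ (fderiv ℝ (h ⟨p, hp⟩)) t (Pi.single i 1) (Pi.single q 1) else 0
  have hH (p i q : Fin n) : H p i q = H p q i := by
    by_cases hp : (p : ℕ) < n - 1
    · simp only [H, hp, dif_pos]
      exact ((hh ⟨p, hp⟩).contDiffAt.isSymmSndFDerivAt (by simp)) _ _
    · simp [H, hp]
  let A' (p : Fin n) : (Fin n → ℝ) →L[ℝ] Fin n → ℝ :=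
    if hp : (p : ℕ) < n - 1 then ContinuousLinearMap.pi fun q =>
      (fderiv ℝ (fderiv ℝ (h ⟨p, hp⟩)) t).flip (Pi.single q 1) else 0
  have hA'_apply (p i : Fin n) : A' p (Pi.single i 1) = H p i := by
    ext q
    by_cases hp : (p : ℕ) < n - 1 <;> simp [A', H, hp]
  have hA' (i p : Fin n) : HasFDerivAt (fun (s : Fin n → ℝ) (q : Fin n) =>
      if hp : (p : ℕ) < n - 1 then fderiv ℝ (h ⟨p, hp⟩) s (Pi.single q 1)
      else if q = i then (1 : ℝ) else 0) (A' p) t := by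
    by_cases hp : (p : ℕ) < n - 1
    · simp only [A', hp, dif_pos]
      have h_diff : HasFDerivAt (fderiv ℝ (h ⟨p, hp⟩)) (fderiv ℝ (fderiv ℝ (h ⟨p, hp⟩)) t) t :=
        (((hh ⟨p, hp⟩).fderiv_right (m := 1) (by norm_num)).differentiable (by simp) t).hasFDerivAt
      refine hasFDerivAt_pi.2 fun q => ?_
      simpa using h_diff.clm_apply (hasFDerivAt_const (Pi.single q (1 : ℝ)) t)
    · simp only [A', hp, dif_neg, not_false_eq_true]
      exact hasFDerivAt_const _ t
  let G : Matrix (Fin n) (Fin n) ℝ := Matrix.of fun p q =>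
    if hp : (p : ℕ) < n - 1 then fderiv ℝ (h ⟨p, hp⟩) t (Pi.single q 1) else 0
  have hG (i : Fin n) : (Matrix.of fun p q : Fin n =>
      if hp : (p : ℕ) < n - 1 then fderiv ℝ (h ⟨p, hp⟩) t (Pi.single q 1)
      else if q = i then (1 : ℝ) else 0) = G.updateRow l (Pi.single i 1) := by
    ext p q
    have hpl : p = l ↔ ¬ (p : ℕ) < n - 1 := by
      rw [Fin.ext_iff]
      have := p.isLt
      simp only [l]
      omega
    by_cases hp : (p : ℕ) < n - 1 <;>
      simp [Matrix.updateRow_apply, G, hpl, hp, Pi.single_apply]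
  have h_deriv (i : Fin n) := Matrix.fderiv_det_apply (hA' i) (Pi.single i 1)
  simp only [h_deriv, hG, hA'_apply]
  rw [Finset.sum_comm]
  refine Finset.sum_eq_zero fun p _ => ?_
  by_cases hp : p = l
  · refine Finset.sum_eq_zero fun i _ => Matrix.det_eq_zero_of_row_eq_zero p fun q => ?_
    simp [hp, H, l]
  · exact Matrix.sum_det_updateRow_single_updateRow_eq_zero G hp (H p) (hH p)
end

section
/- Let k = ℝ or k = ℂ and S = k[x_1,…,x_n]. Let X^1, X^2, …, X^{p+m} be pairwise commuting k-linear derivations of S, let g ∈ S, and let f_1,…,f_p ∈ S. For a_1,…,a_m ∈ S, setting f_{p+1} := a_1, …, f_{p+m} := a_m, define {a_1,…,a_m} := g · det( (X^ν(f_μ))_{μ,ν = 1,…,p+m} ). Then {·,…,·} is a Nambu-Poisson bracket of arity m on S. -/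
/-- Append an element `x` at the end of an `(m-1)`-tuple, producing an `m`-tuple. -/
def snocFun {α : Type*} (m : ℕ) (f : Fin (m - 1) → α) (x : α) : Fin m → α :=
  fun i => if h : (i : ℕ) < m - 1 then f ⟨i, h⟩ else x

/-- A Nambu-Poisson bracket of arity `m` on a commutative `k`-algebra `A`. -/
structure IsNambuPoisson (k : Type*) {A : Type*} [CommRing k] [CommRing A] [Algebra k A]
    (m : ℕ) (br : (Fin m → A) → A) : Prop where
  multilinear : ∀ (v : Fin m → A) (i : Fin m),
    IsLinearMap k (fun x : A => br (Function.update v i x))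
  antisymm : ∀ (v : Fin m → A) (σ : Equiv.Perm (Fin m)),
    br (fun i => v (σ i)) = (Equiv.Perm.sign σ : ℤ) • br v
  leibniz : ∀ (g : Fin (m - 1) → A) (a b : A),
    br (snocFun m g (a * b)) = a * br (snocFun m g b) + b * br (snocFun m g a)
  fundamental : ∀ (g : Fin (m - 1) → A) (h : Fin m → A),
    br (snocFun m g (br h)) =
      ∑ l : Fin m, br (Function.update h l (br (snocFun m g (h l))))

/-- The determinantal bracket `{a₁,…,a_m} := g · det(Xᵛ(f_μ))` where the last `m`
of the `f`'s are the arguments `a₁,…,a_m`. -/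
noncomputable def detBracket (k : Type*) [CommRing k] (n m p : ℕ)
    (X : Fin (p + m) → Derivation k (MvPolynomial (Fin n) k) (MvPolynomial (Fin n) k))
    (g : MvPolynomial (Fin n) k) (f : Fin p → MvPolynomial (Fin n) k) :
    (Fin m → MvPolynomial (Fin n) k) → MvPolynomial (Fin n) k :=
  fun a =>
    g * Matrix.det (Matrix.of fun μ ν : Fin (p + m) => X ν (Fin.append f a μ))

/-- The Leibniz rule for a finite product. -/
theorem Derivation.map_finset_prod {k A ι : Type*} [CommRing k] [CommRing A] [Algebra k A]
    [DecidableEq ι] (D : Derivation k A A) (s : Finset ι) (f : ι → A) :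
    D (∏ i ∈ s, f i) = ∑ i ∈ s, D (f i) * ∏ j ∈ s.erase i, f j := by
  induction s using Finset.induction_on with
  | empty => simp
  | insert a s ha ih =>
    rw [Finset.prod_insert ha, D.leibniz, ih, Finset.sum_insert ha, Finset.erase_insert ha,
      smul_eq_mul, smul_eq_mul, Finset.mul_sum, add_comm, mul_comm]
    congr 1
    refine Finset.sum_congr rfl fun i hi => ?_
    have hia : a ≠ i := fun h => ha (h ▸ hi)
    rw [Finset.erase_insert_of_ne hia,
      Finset.prod_insert fun h => ha (Finset.mem_of_mem_erase h)]
    ring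

/-- A derivation acts on a determinant one row at a time. -/
theorem Derivation.map_det {k A ι : Type*} [CommRing k] [CommRing A] [Algebra k A]
    [Fintype ι] [DecidableEq ι] (D : Derivation k A A) (M : Matrix ι ι A) :
    D M.det = ∑ i, (M.updateRow i fun j => D (M i j)).det := by
  have key (N : Matrix ι ι A) :
      N.det = ∑ σ : Equiv.Perm ι, Equiv.Perm.sign σ • ∏ i, N i (σ i) := by
    rw [← Matrix.det_transpose, Matrix.det_apply]
    rfl
  simp_rw [key]
  rw [map_sum, Finset.sum_comm]
  refine Finset.sum_congr rfl fun σ _ => ?_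
  rw [← Finset.smul_sum, Units.smul_def, Units.smul_def, map_zsmul, D.map_finset_prod]
  congr 1
  refine Finset.sum_congr rfl fun i _ => ?_
  rw [← Finset.mul_prod_erase _ _ (Finset.mem_univ i), Matrix.updateRow_self]
  congr 1
  refine Finset.prod_congr rfl fun j hj => ?_
  rw [Matrix.updateRow_ne (Finset.ne_of_mem_erase hj)]

namespace Matrix

variable {A ι : Type*} [CommRing A] [Fintype ι] [DecidableEq ι]

/-- Laplace expansion of a determinant along a replaced row. -/
theorem det_updateRow_eq_sum_adjugate (M : Matrix ι ι A) (j : ι) (v : ι → A) :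
    (M.updateRow j v).det = ∑ l, v l * M.adjugate l j := by
  rw [← cramer_transpose_apply, cramer_eq_adjugate_mulVec, ← adjugate_transpose]
  simp [mulVec, dotProduct, mul_comm]

/-- Replacing in turn each row of `M` by the corresponding row of `M * C` multiplies the
determinant by the trace of `C`. -/
theorem sum_det_updateRow_mul (M C : Matrix ι ι A) :
    ∑ i, (M.updateRow i ((M * C) i)).det = C.trace * M.det := by
  simp_rw [det_updateRow_eq_sum_adjugate]
  trans (M * C * M.adjugate).trace
  · rfl
  · rw [trace_mul_comm, ← Matrix.mul_assoc, adjugate_mul]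
    simp [mul_comm]

end Matrix

section Jacobian

open Matrix

variable {k A ι : Type*} [CommRing k] [CommRing A] [Algebra k A]

/-- The matrix `(X^ν (F_μ))` of the family `F` with respect to the derivations `X`. -/
def jacobianMatrix (X : ι → Derivation k A A) (F : ι → A) : Matrix ι ι A :=
  Matrix.of fun μ ν => X ν (F μ)

@[simp]
theorem jacobianMatrix_apply (X : ι → Derivation k A A) (F : ι → A) (μ ν : ι) :
    jacobianMatrix X F μ ν = X ν (F μ) := rfl

variable [DecidableEq ι]

theorem jacobianMatrix_update (X : ι → Derivation k A A) (F : ι → A) (i : ι) (a : A) :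
    jacobianMatrix X (Function.update F i a) =
      (jacobianMatrix X F).updateRow i fun ν => X ν a := by
  ext μ ν
  by_cases h : μ = i
  · subst h; simp
  · simp [h]

variable [Fintype ι]

theorem det_jacobianMatrix_update (X : ι → Derivation k A A) (F : ι → A) (i : ι) (a : A) :
    (jacobianMatrix X (Function.update F i a)).det =
      ∑ l, X l a * (jacobianMatrix X F).adjugate l i := by
  rw [jacobianMatrix_update, det_updateRow_eq_sum_adjugate]

/-- The Piola identity: the cofactors along a row of a Jacobian matrix are divergence free. -/
theorem sum_derivation_adjugate_jacobianMatrix (X : ι → Derivation k A A)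
    (hX : ∀ i j a, X i (X j a) = X j (X i a)) (F : ι → A) (j : ι) :
    ∑ l, X l ((jacobianMatrix X F).adjugate l j) = 0 := by
  simp_rw [adjugate_apply, Derivation.map_det]
  rw [Finset.sum_comm]
  refine Finset.sum_eq_zero fun i _ => ?_
  set J := jacobianMatrix X F
  by_cases hij : i = j
  · subst hij
    refine Finset.sum_eq_zero fun l _ => det_eq_zero_of_row_eq_zero i fun ν => ?_
    by_cases h : ν = l
    · subst h; simp
    · simp [h]
  have expand (l : ι) : ((J.updateRow j (Pi.single l 1)).updateRow i
      fun ν => X l (J.updateRow j (Pi.single l 1) i ν)).det =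
      ∑ ν, X l (X ν (F i)) *
        ((J.updateRow j (Pi.single l 1)).updateRow i (Pi.single ν 1)).det := by
    rw [det_updateRow_eq_sum_adjugate]
    simp [adjugate_apply, hij, J]
  simp_rw [expand]
  rw [← Finset.sum_product']
  have hswap (a b : ι) : ((J.updateRow j (Pi.single b 1)).updateRow i (Pi.single a 1)).det =
      -((J.updateRow j (Pi.single a 1)).updateRow i (Pi.single b 1)).det := by
    have h := det_permute (Equiv.swap i j)
      ((J.updateRow j (Pi.single a 1)).updateRow i (Pi.single b 1))
    rw [Equiv.Perm.sign_swap hij] at h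
    simp only [Units.val_neg, Units.val_one, Int.cast_neg, Int.cast_one, neg_one_mul] at h
    rw [← h]
    congr 1
    ext μ ν
    rcases eq_or_ne μ i with rfl | hi
    · simp [updateRow_ne (Ne.symm hij)]
    rcases eq_or_ne μ j with rfl | hj
    · simp [updateRow_ne (Ne.symm hij)]
    · simp [hi, hj, Equiv.swap_apply_of_ne_of_ne hi hj]
  refine Finset.sum_involution (fun a _ => a.swap) ?_ ?_ (by simp) (by simp)
  · rintro ⟨a, b⟩ -
    simp only [Prod.fst_swap, Prod.snd_swap]
    rw [hX b a, hswap a b]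
    ring
  · rintro ⟨a, b⟩ - hne hab
    obtain rfl : b = a := congrArg Prod.fst hab
    refine hne ?_
    rw [det_zero_of_row_eq hij (by simp [updateRow_ne (Ne.symm hij)]), mul_zero]

/-- The fundamental identity for the bracket `g * det (X^ν (F_μ))`. -/
theorem jacobian_fundamental (X : ι → Derivation k A A)
    (hX : ∀ i j a, X i (X j a) = X j (X i a)) (g : A) (u F : ι → A) (j : ι) :
    g * (jacobianMatrix X (Function.update u j (g * (jacobianMatrix X F).det))).det =
      ∑ i, g * (jacobianMatrix X (Function.update F i
        (g * (jacobianMatrix X (Function.update u j (F i))).det))).det := by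
  let c : ι → A := fun l => g * (jacobianMatrix X u).adjugate l j
  let D : Derivation k A A := ∑ l, c l • X l
  let J := jacobianMatrix X F
  let C : Matrix ι ι A := Matrix.of fun l ν => X ν (c l)
  have hDc (a : A) : D a = ∑ l, c l * X l a := by
    have h := congrFun (map_sum (Derivation.coeFnAddMonoidHom (R := k) (A := A) (M := A))
      (fun l => c l • X l) Finset.univ) a
    exact h.trans (by simp [Derivation.coeFnAddMonoidHom_apply])
  have hD (a : A) : g * (jacobianMatrix X (Function.update u j a)).det = D a := by
    simp only [det_jacobianMatrix_update, hDc, c, Finset.mul_sum]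
    exact Finset.sum_congr rfl fun l _ => by ring
  have hdiv : g * C.trace = D g := by
    have h := sum_derivation_adjugate_jacobianMatrix X hX u j
    rw [← hD, det_jacobianMatrix_update]
    congr 1
    simp only [C, c, Matrix.trace, Matrix.diag, Matrix.of_apply, Derivation.leibniz, smul_eq_mul,
      Finset.sum_add_distrib, ← Finset.mul_sum, h, mul_zero, zero_add]
    exact Finset.sum_congr rfl fun l _ => mul_comm _ _
  have hrow (i : ι) : (fun ν => X ν (D (F i))) = (fun ν => D (J i ν)) + (J * C) i := by
    ext ν
    simp only [hDc, C, J, smul_eq_mul, map_sum, Derivation.leibniz, Finset.sum_add_distrib, Pi.add_apply, Matrix.mul_apply,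
      jacobianMatrix_apply, Matrix.of_apply, hX ν]
  simp_rw [hD, jacobianMatrix_update, hrow, det_updateRow_add]
  rw [← Finset.mul_sum, Finset.sum_add_distrib, sum_det_updateRow_mul, ← Derivation.map_det,
    D.leibniz, smul_eq_mul, smul_eq_mul, mul_add, ← mul_assoc g, hdiv]
  ring

end Jacobian

theorem Fin.append_update_right {α : Type*} {p m : ℕ} (f : Fin p → α) (h : Fin m → α)
    (i : Fin m) (x : α) :
    Fin.append f (Function.update h i x) =
      Function.update (Fin.append f h) (Fin.natAdd p i) x := by
  ext μ
  refine Fin.addCases (fun a => ?_) (fun b => ?_) μ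
  · rw [Function.update_of_ne (by simp [Fin.ext_iff]; omega)]
    simp
  · by_cases hb : b = i
    · subst hb; simp
    · simp [hb]

theorem snocFun_eq_update {α : Type*} {m : ℕ} (hm : m - 1 < m) (f : Fin (m - 1) → α) (x y : α) :
    snocFun m f x = Function.update (snocFun m f y) ⟨m - 1, hm⟩ x := by
  ext i
  by_cases hi : i = ⟨m - 1, hm⟩
  · subst hi; simp [snocFun]
  · have : (i : ℕ) < m - 1 := by
      rw [Fin.ext_iff] at hi
      exact lt_of_le_of_ne (Nat.le_sub_one_of_lt i.isLt) hi
    simp [snocFun, hi, this]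

section detBracket

variable {k : Type*} [CommRing k] {n m p : ℕ}
  (X : Fin (p + m) → Derivation k (MvPolynomial (Fin n) k) (MvPolynomial (Fin n) k))
  (g : MvPolynomial (Fin n) k) (f : Fin p → MvPolynomial (Fin n) k)

theorem detBracket_eq (a : Fin m → MvPolynomial (Fin n) k) :
    detBracket k n m p X g f a = g * (jacobianMatrix X (Fin.append f a)).det := rfl

theorem detBracket_update (a : Fin m → MvPolynomial (Fin n) k) (i : Fin m)
    (b : MvPolynomial (Fin n) k) :
    detBracket k n m p X g f (Function.update a i b) = g * (jacobianMatrix X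
      (Function.update (Fin.append f a) (Fin.natAdd p i) b)).det := by
  rw [detBracket_eq, Fin.append_update_right]

theorem detBracket_comp_perm (v : Fin m → MvPolynomial (Fin n) k) (σ : Equiv.Perm (Fin m)) :
    detBracket k n m p X g f (fun i => v (σ i)) =
      (Equiv.Perm.sign σ : ℤ) • detBracket k n m p X g f v := by
  let τ : Equiv.Perm (Fin (p + m)) :=
    finSumFinEquiv.permCongr (Equiv.Perm.sumCongr (1 : Equiv.Perm (Fin p)) σ)
  have hτ : Equiv.Perm.sign τ = Equiv.Perm.sign σ := by
    simp [τ, Equiv.Perm.sign_permCongr, Equiv.Perm.sign_sumCongr]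
  have happ : jacobianMatrix X (Fin.append f fun i => v (σ i)) =
      (jacobianMatrix X (Fin.append f v)).submatrix τ id := by
    ext1 μ ν
    refine Fin.addCases (fun a => ?_) (fun b => ?_) μ <;> simp [τ, Equiv.permCongr_apply]
  rw [detBracket_eq, detBracket_eq, happ, Matrix.det_permute, hτ, zsmul_eq_mul]
  ring

end detBracket

/-- for `k = ℝ` or `ℂ` (`RCLike k`), pairwise commuting derivations
`X¹,…,X^{p+m}` of `S = k[x₁,…,xₙ]`, `g ∈ S` and `f₁,…,f_p ∈ S`, the determinantal
bracket `{a₁,…,a_m} := g · det((Xᵛ(f_μ))_{μ,ν=1,…,p+m})` (with `f_{p+i} := a_i`)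
is a Nambu-Poisson bracket of arity `m` on `S`. -/
theorem detBracket_isNambuPoisson
    (k : Type*) [RCLike k] (n m p : ℕ) (hm : 2 ≤ m)
    (X : Fin (p + m) → Derivation k (MvPolynomial (Fin n) k) (MvPolynomial (Fin n) k))
    (hcomm : ∀ (i j : Fin (p + m)) (f : MvPolynomial (Fin n) k),
      X i (X j f) = X j (X i f))
    (g : MvPolynomial (Fin n) k) (f : Fin p → MvPolynomial (Fin n) k) :
    IsNambuPoisson k m (detBracket k n m p X g f) := by
  have hm1 : m - 1 < m := by omega
  refine ⟨fun v i => ?_, detBracket_comp_perm X g f, fun u a b => ?_, fun u h => ?_⟩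
  · simp_rw [detBracket_update, det_jacobianMatrix_update]
    constructor
    · intro x y
      simp only [map_add, add_mul, Finset.sum_add_distrib, mul_add]
    · intro c x
      simp only [Derivation.map_smul, smul_mul_assoc, ← Finset.smul_sum, mul_smul_comm]
  · obtain ⟨w, hw⟩ : ∃ w, ∀ x, snocFun m u x = Function.update w ⟨m - 1, hm1⟩ x :=
      ⟨snocFun m u 0, fun x => snocFun_eq_update hm1 u x 0⟩
    simp_rw [hw, detBracket_update, det_jacobianMatrix_update,
      Derivation.leibniz, smul_eq_mul, add_mul, Finset.sum_add_distrib, mul_assoc,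
      ← Finset.mul_sum]
    ring
  · obtain ⟨w, hw⟩ : ∃ w, ∀ x, snocFun m u x = Function.update w ⟨m - 1, hm1⟩ x :=
      ⟨snocFun m u 0, fun x => snocFun_eq_update hm1 u x 0⟩
    simp_rw [hw, detBracket_update]
    rw [detBracket_eq, jacobian_fundamental X hcomm, Fin.sum_univ_add]
    simp_rw [Fin.append_right]
    refine add_eq_right.mpr (Finset.sum_eq_zero fun i _ => ?_)
    have hne : Fin.castAdd m i ≠ Fin.natAdd p (⟨m - 1, hm1⟩ : Fin m) := by
      simp only [ne_eq, Fin.ext_iff, Fin.val_castAdd, Fin.val_natAdd]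
      omega
    have hzero : (jacobianMatrix X (Function.update (Fin.append f w)
        (Fin.natAdd p ⟨m - 1, hm1⟩) (Fin.append f h (Fin.castAdd m i)))).det = 0 := by
      refine Matrix.det_zero_of_row_eq hne (funext fun ν => ?_)
      rw [jacobianMatrix_apply, jacobianMatrix_apply, Function.update_of_ne hne,
        Function.update_self, Fin.append_left, Fin.append_left]
    rw [hzero, det_jacobianMatrix_update]
    simp
end

section
/- Let (A, {·,…,·}_p) and (B, {·,…,·}_q) be Nambu-Poisson algebras over k of arities p and q, and let {·,…,·}_{p+q} be any bracket of arity n := p+q on A ⊗_k B that is k-multilinear, totally antisymmetric, satisfies the Leibniz rule in each argument, and satisfies {a_1⊗1, …, a_p⊗1, 1⊗b_1, …, 1⊗b_q}_{n} = {a_1,…,a_p}_p ⊗ {b_1,…,b_q}_q together with {a_1⊗1, …, a_i⊗1, 1⊗b_1, …, 1⊗b_j}_{n} = 0 whenever i + j = n, i ≠ p. Then for all a_1,…,a_n ∈ A and b_1,…,b_n ∈ B one has {a_1⊗b_1, …, a_n⊗b_n}_{n} = Σ_{σ ∈ Sh^{-1}_{p,q}} sgn(σ) · ( a_{σ(p+1)}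 ⋯ a_{σ(n)} · {a_{σ(1)},…,a_{σ(p)}}_p ) ⊗ ( b_{σ(1)} ⋯ b_{σ(p)} · {b_{σ(p+1)},…,b_{σ(n)}}_q ), where Sh^{-1}_{p,q} denotes the set of (p,q)-unshuffle permutations of {1,…,n}, i.e. permutations σ with σ(1) < ⋯ < σ(p) and σ(p+1) < ⋯ < σ(n). -/
open scoped TensorProduct

/-- `(p,q)`-unshuffle permutations of `Fin (p + q)`: strictly increasing on the
first `p` indices and on the last `q` indices. -/
def IsUnshuffle (p q : ℕ) (σ : Equiv.Perm (Fin (p + q))) : Prop :=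
  (∀ i j : Fin (p + q), (i : ℕ) < (j : ℕ) → (j : ℕ) < p → σ i < σ j) ∧
  (∀ i j : Fin (p + q), p ≤ (i : ℕ) → (i : ℕ) < (j : ℕ) → σ i < σ j)

instance (p q : ℕ) : DecidablePred (IsUnshuffle p q) := fun σ => by
  unfold IsUnshuffle; infer_instance

/-- Expansion of a multiderivation evaluated on a tuple of products, over the coordinates in `s`. -/
theorem multiderivation_piecewise_mul {ι R : Type*} [DecidableEq ι] [CommRing R]
    (D : (ι → R) → R)
    (hD : ∀ (v : ι → R) (i : ι) (x y : R), D (Function.update v i (x * y)) =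
      x * D (Function.update v i y) + y * D (Function.update v i x))
    (x y : ι → R) (s : Finset ι) (v : ι → R) :
    D (s.piecewise (fun t => x t * y t) v) =
      ∑ S ∈ s.powerset, (∏ t ∈ s, S.piecewise y x t) *
        D (s.piecewise (S.piecewise x y) v) := by
  induction s using Finset.induction_on generalizing v with
  | empty => simp
  | insert i s hi ih =>
    rw [Finset.piecewise_insert, Finset.update_piecewise_of_notMem (hi := hi), ih,
      Finset.sum_powerset_insert hi, ← Finset.sum_add_distrib]
    refine Finset.sum_congr rfl fun S hS => ?_
    have hiS : i ∉ S := fun h => hi (Finset.mem_powerset.mp hS h)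
    have hne : ∀ t ∈ s, t ≠ i := fun t ht h => hi (h ▸ ht)
    have hprod : ∏ t ∈ s, (insert i S).piecewise y x t = ∏ t ∈ s, S.piecewise y x t :=
      Finset.prod_congr rfl fun t ht => by
        rw [Finset.piecewise_insert_of_ne _ _ _ (hne t ht)]
    have hpw : s.piecewise ((insert i S).piecewise x y) v = s.piecewise (S.piecewise x y) v :=
      Finset.piecewise_congr _ (fun t ht => by
        rw [Finset.piecewise_insert_of_ne _ _ _ (hne t ht)]) fun _ _ => rfl
    rw [Finset.prod_insert hi, Finset.prod_insert hi, hprod,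
      Finset.piecewise_insert (g := v), Finset.piecewise_insert (g := v), hpw,
      Finset.piecewise_insert_self, Finset.piecewise_insert_self,
      Finset.piecewise_eq_of_notMem _ _ _ hiS, Finset.piecewise_eq_of_notMem _ _ _ hiS,
      ← Finset.update_piecewise_of_notMem _ _ _ hi, hD]
    ring

theorem multiderivation_mul {ι R : Type*} [DecidableEq ι] [Fintype ι] [CommRing R]
    (D : (ι → R) → R)
    (hD : ∀ (v : ι → R) (i : ι) (x y : R), D (Function.update v i (x * y)) =
      x * D (Function.update v i y) + y * D (Function.update v i x))
    (x y : ι → R) :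
    D (fun t => x t * y t) =
      ∑ S : Finset ι, (∏ t, S.piecewise y x t) * D (S.piecewise x y) := by
  simpa using multiderivation_piecewise_mul D hD x y Finset.univ x

/-- The image of the first `p` indices under a permutation of `Fin (p + q)`. -/
def leftBlock {p q : ℕ} (σ : Equiv.Perm (Fin (p + q))) : Finset (Fin (p + q)) :=
  Finset.univ.map ((Fin.castAddEmb q).trans σ.toEmbedding)

theorem apply_castAdd_mem_leftBlock {p q : ℕ} (σ : Equiv.Perm (Fin (p + q))) (l : Fin p) :
    σ (Fin.castAdd q l) ∈ leftBlock σ := by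
  simp [leftBlock]

theorem apply_natAdd_notMem_leftBlock {p q : ℕ} (σ : Equiv.Perm (Fin (p + q))) (l : Fin q) :
    σ (Fin.natAdd p l) ∉ leftBlock σ := by
  simp only [leftBlock, Finset.mem_map, Finset.mem_univ, true_and, not_exists]
  intro m hm
  have h := congrArg Fin.val (σ.injective hm)
  simp at h
  omega

theorem card_leftBlock {p q : ℕ} (σ : Equiv.Perm (Fin (p + q))) :
    (leftBlock σ).card = p := by
  simp [leftBlock]

theorem IsUnshuffle.eq_of_leftBlock_eq {p q : ℕ} {σ τ : Equiv.Perm (Fin (p + q))}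
    (hσ : IsUnshuffle p q σ) (hτ : IsUnshuffle p q τ) (h : leftBlock σ = leftBlock τ) :
    σ = τ := by
  have hc : (leftBlock τ)ᶜ.card = q := by simp [Finset.card_compl, card_leftBlock]
  have left : ∀ ρ, IsUnshuffle p q ρ → leftBlock ρ = leftBlock τ →
      (fun l : Fin p => ρ (Fin.castAdd q l)) =
        (leftBlock τ).orderEmbOfFin (card_leftBlock τ) := fun ρ hρ e =>
    Finset.orderEmbOfFin_unique _ (fun l => e ▸ apply_castAdd_mem_leftBlock ρ l)
      fun i j hij => hρ.1 _ _ hij j.isLt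
  have right : ∀ ρ, IsUnshuffle p q ρ → leftBlock ρ = leftBlock τ →
      (fun l : Fin q => ρ (Fin.natAdd p l)) = (leftBlock τ)ᶜ.orderEmbOfFin hc := fun ρ hρ e =>
    Finset.orderEmbOfFin_unique _
      (fun l => Finset.mem_compl.mpr (e ▸ apply_natAdd_notMem_leftBlock ρ l))
      fun i j hij => hρ.2 _ _ (by simp) (by simpa using hij)
  ext1 t
  refine Fin.addCases (fun l => ?_) (fun l => ?_) t
  · exact congrFun ((left σ hσ h).trans (left τ hτ rfl).symm) l
  · exact congrFun ((right σ hσ h).trans (right τ hτ rfl).symm) l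

theorem exists_isUnshuffle_leftBlock_eq {p q : ℕ} {S : Finset (Fin (p + q))}
    (hS : S.card = p) : ∃ σ, IsUnshuffle p q σ ∧ leftBlock σ = S := by
  have hc : Sᶜ.card = q := by simp [Finset.card_compl, hS]
  let σ : Equiv.Perm (Fin (p + q)) :=
    finSumFinEquiv.symm.trans (finSumEquivOfFinset hS hc)
  have hl : ∀ l, σ (Fin.castAdd q l) = S.orderEmbOfFin hS l := fun l => by simp [σ]
  have hr : ∀ l, σ (Fin.natAdd p l) = Sᶜ.orderEmbOfFin hc l := fun l => by simp [σ]
  refine ⟨σ, ⟨fun i j => ?_, fun i j => ?_⟩, ?_⟩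
  · refine Fin.addCases (fun i => ?_) (fun i => ?_) i <;>
      refine Fin.addCases (fun j => ?_) (fun j => ?_) j <;> intro h1 h2
    · rw [hl, hl]
      exact (S.orderEmbOfFin hS).strictMono h1
    all_goals simp at h1 h2 <;> omega
  · refine Fin.addCases (fun i => ?_) (fun i => ?_) i <;>
      refine Fin.addCases (fun j => ?_) (fun j => ?_) j <;> intro h1 h2
    rotate_right
    · rw [hr, hr]
      exact (Sᶜ.orderEmbOfFin hc).strictMono (by simpa using h2)
    all_goals simp at h1 h2; omega
  · refine Finset.eq_of_subset_of_card_le (fun t ht => ?_) (by rw [hS, card_leftBlock])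
    obtain ⟨l, -, rfl⟩ := Finset.mem_map.mp ht
    exact (hl l).symm ▸ Finset.orderEmbOfFin_mem S hS l

/-- Sorting a tuple whose entries are given by `x` on `S` and by `y` off `S`. -/
theorem exists_perm_piecewise_eq_append {α : Type*} {n i j : ℕ} (h : i + j = n)
    {S : Finset (Fin n)} (hS : S.card = i) (x y : Fin n → α) :
    ∃ (σ : Equiv.Perm (Fin n)) (f : Fin i → Fin n) (g : Fin j → Fin n),
      (fun t => S.piecewise x y (σ t)) = fun t =>
        Fin.append (fun l => x (f l)) (fun l => y (g l)) (Fin.cast h.symm t) := by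
  subst h
  obtain ⟨σ, -, rfl⟩ := exists_isUnshuffle_leftBlock_eq hS
  refine ⟨σ, fun l => σ (Fin.castAdd j l), fun l => σ (Fin.natAdd i l), funext fun t => ?_⟩
  refine Fin.addCases (fun l => ?_) (fun l => ?_) t
  · simp [apply_castAdd_mem_leftBlock]
  · simp [apply_natAdd_notMem_leftBlock]

/-- any `k`-multilinear, totally antisymmetric bracket of arity
`n = p + q` on `A ⊗[k] B` satisfying the Leibniz rule in each argument together with
the outer-tensor-product conditions (i) and (ii) is given on pure tensors by the
unshuffle formula. -/
theorem outerTensorProduct_formula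
    (k A B : Type*) [Field k] [CharZero k]
    [CommRing A] [Algebra k A] [CommRing B] [Algebra k B]
    (p q : ℕ) (hp : 2 ≤ p) (hq : 2 ≤ q)
    (brA : (Fin p → A) → A) (brB : (Fin q → B) → B)
    (hA : IsNambuPoisson k p brA) (hB : IsNambuPoisson k q brB)
    (br : (Fin (p + q) → A ⊗[k] B) → A ⊗[k] B)
    (hml : ∀ (v : Fin (p + q) → A ⊗[k] B) (i : Fin (p + q)),
      IsLinearMap k (fun x : A ⊗[k] B => br (Function.update v i x)))
    (hanti : ∀ (v : Fin (p + q) → A ⊗[k] B) (σ : Equiv.Perm (Fin (p + q))),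
      br (fun i => v (σ i)) = (Equiv.Perm.sign σ : ℤ) • br v)
    (hleib : ∀ (v : Fin (p + q) → A ⊗[k] B) (i : Fin (p + q)) (x y : A ⊗[k] B),
      br (Function.update v i (x * y)) =
        x * br (Function.update v i y) + y * br (Function.update v i x))
    (hi : ∀ (a : Fin p → A) (b : Fin q → B),
      br (Fin.append (fun i => a i ⊗ₜ[k] (1 : B)) (fun j => (1 : A) ⊗ₜ[k] b j)) =
        brA a ⊗ₜ[k] brB b)
    (hii : ∀ (i j : ℕ) (h : i + j = p + q), i ≠ p →
      ∀ (a : Fin i → A) (b : Fin j → B),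
        br (fun t =>
          Fin.append (fun s => a s ⊗ₜ[k] (1 : B)) (fun s => (1 : A) ⊗ₜ[k] b s)
            (Fin.cast h.symm t)) = 0)
    (a : Fin (p + q) → A) (b : Fin (p + q) → B) :
    br (fun t => a t ⊗ₜ[k] b t) =
      ∑ σ ∈ Finset.univ.filter (IsUnshuffle p q),
        (Equiv.Perm.sign σ : ℤ) •
          (((∏ l : Fin q, a (σ (Fin.natAdd p l))) *
              brA (fun l : Fin p => a (σ (Fin.castAdd q l)))) ⊗ₜ[k]
            ((∏ l : Fin p, b (σ (Fin.castAdd q l))) *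
              brB (fun l : Fin q => b (σ (Fin.natAdd p l))))) := by
  let x : Fin (p + q) → A ⊗[k] B := fun t => a t ⊗ₜ[k] 1
  let y : Fin (p + q) → A ⊗[k] B := fun t => 1 ⊗ₜ[k] b t
  have hxy : (fun t => a t ⊗ₜ[k] b t) = fun t => x t * y t := by
    simp [x, y]
  have hsign : ∀ (v : Fin (p + q) → A ⊗[k] B) (σ : Equiv.Perm (Fin (p + q))),
      br v = (Equiv.Perm.sign σ : ℤ) • br (fun i => v (σ i)) := fun v σ => by
    rw [hanti, smul_smul, ← Units.val_mul, Int.units_mul_self, Units.val_one, one_smul]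
  rw [hxy, multiderivation_mul br hleib x y]
  symm
  refine Finset.sum_of_injOn leftBlock ?_ (fun _ _ => Finset.mem_coe.mpr (Finset.mem_univ _))
    ?_ ?_
  · intro σ hσ τ hτ h
    simp only [Finset.coe_filter, Finset.mem_univ, true_and, Set.mem_ofPred_eq] at hσ hτ
    exact hσ.eq_of_leftBlock_eq hτ h
  · intro S _ hS
    have hcard : S.card ≠ p := fun hc => by
      obtain ⟨σ, hσ, rfl⟩ := exists_isUnshuffle_leftBlock_eq hc
      exact hS ⟨σ, by simpa using hσ, rfl⟩
    have hle : S.card + (p + q - S.card) = p + q :=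
      Nat.add_sub_cancel' (by simpa using S.card_le_univ)
    obtain ⟨σ, f, g, hσ⟩ := exists_perm_piecewise_eq_append hle rfl x y
    rw [hsign _ σ, hσ, hii _ _ hle hcard (fun l => a (f l)) (fun l => b (g l)), smul_zero,
      mul_zero]
  · intro σ _
    have hv : (fun t => (leftBlock σ).piecewise x y (σ t)) =
        Fin.append (fun l => a (σ (Fin.castAdd q l)) ⊗ₜ[k] (1 : B))
          (fun l => (1 : A) ⊗ₜ[k] b (σ (Fin.natAdd p l))) := funext fun t => by
      refine Fin.addCases (fun l => ?_) (fun l => ?_) t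
      · simp [apply_castAdd_mem_leftBlock, x]
      · simp [apply_natAdd_notMem_leftBlock, y]
    have hprod : ∏ t, (leftBlock σ).piecewise y x t =
        (∏ l : Fin q, a (σ (Fin.natAdd p l))) ⊗ₜ[k]
          (∏ l : Fin p, b (σ (Fin.castAdd q l))) := by
      rw [← Equiv.prod_comp σ, Fin.prod_univ_add]
      simp only [apply_castAdd_mem_leftBlock, apply_natAdd_notMem_leftBlock,
        Finset.piecewise_eq_of_mem, Finset.piecewise_eq_of_notMem, not_false_eq_true, x, y]
      have hl := map_prod (Algebra.TensorProduct.includeLeft : A →ₐ[k] A ⊗[k] B)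
        (fun l : Fin q => a (σ (Fin.natAdd p l))) Finset.univ
      have hr := map_prod (Algebra.TensorProduct.includeRight : B →ₐ[k] A ⊗[k] B)
        (fun l : Fin p => b (σ (Fin.castAdd q l))) Finset.univ
      simp only [Algebra.TensorProduct.includeLeft_apply,
        Algebra.TensorProduct.includeRight_apply] at hl hr
      rw [← hl, ← hr, Algebra.TensorProduct.tmul_mul_tmul, one_mul, mul_one]
    rw [hsign _ σ, hv, hi, hprod, mul_smul_comm, Algebra.TensorProduct.tmul_mul_tmul]
end

section
/- Let m ≥ 2 be even, let S = k[x_1,…,x_n] carry a Nambu-Poisson bracket of arity m given by {g_1,…,g_m} = Σ Π_{i_1…i_m} (∂g_1/∂x_{i_1})⋯(∂g_m/∂x_{i_m}) with Π_{i_1…i_m} = {x_{i_1},…,x_{i_m}}, and let I = (f_1,…,f_p) be a Nambu-Poisson ideal with chosen coefficients Z^ν_{i_1…i_{m-1} μ} ∈ S satisfying {x_{i_1},…,x_{i_{m-1}}, f_μ} = Σ_{ν=1}^{p} Z^ν_{i_1…i_{m-1} μ} f_ν. Then for all indices i_1,…,i_{m-1}, j_1,…,j_{m-1} ∈ {1,…,n}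 and all μ ∈ {1,…,p}, the element Σ_{ν=1}^{p} [ X_{x_{i_1},…,x_{i_{m-1}}}(Z^ν_{j_1…j_{m-1} μ}) − X_{x_{j_1},…,x_{j_{m-1}}}(Z^ν_{i_1…i_{m-1} μ}) + Σ_{λ=1}^{p} ( Z^λ_{j_1…j_{m-1} μ} Z^ν_{i_1…i_{m-1} λ} − Z^λ_{i_1…i_{m-1} μ} Z^ν_{j_1…j_{m-1} λ} ) − Σ_{r=1}^{n} Σ_{l=1}^{m-1} (∂Π_{i_1…i_{m-1} j_l}/∂x_r) · Z^ν_{j_1…j_{l-1} r j_{l+1}…j_{m-1} μ} ] · f_ν lies in the ideal I²; equivalently, the Nambu connection on the conormal module I/I² defined by the Z's is flat. -/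
theorem comp_snocFun {α β : Type*} (m : ℕ) (φ : α → β) (g : Fin (m - 1) → α) (x : α) :
    (fun j => φ (snocFun m g x j)) = snocFun m (fun s => φ (g s)) (φ x) := by
  funext j
  unfold snocFun
  split_ifs <;> rfl

theorem update_snocFun_last {α : Type*} {m : ℕ} (g : Fin m → α) (x y : α) :
    Function.update (snocFun (m + 1) g x) (Fin.last m) y = snocFun (m + 1) g y := by
  funext j
  rcases Fin.eq_castSucc_or_eq_last j with ⟨i, rfl⟩ | rfl
  · rw [Function.update_of_ne (Fin.castSucc_lt_last i).ne]
    simp [snocFun]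
  · simp [snocFun]

theorem update_snocFun_castSucc {α : Type*} {m : ℕ} (g : Fin m → α) (x y : α) (l : Fin m) :
    Function.update (snocFun (m + 1) g x) l.castSucc y =
      snocFun (m + 1) (Function.update g l y) x := by
  funext j
  rcases Fin.eq_castSucc_or_eq_last j with ⟨i, rfl⟩ | rfl
  · by_cases h : i = l
    · subst h
      simp [snocFun]
    · rw [Function.update_of_ne (by simpa using h)]
      simp [snocFun, h]
  · rw [Function.update_of_ne (Fin.castSucc_lt_last l).ne']
    simp [snocFun]

theorem snocFun_castSucc {α : Type*} {m : ℕ} (g : Fin m → α) (x : α) (l : Fin m) :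
    snocFun (m + 1) g x l.castSucc = g l := by
  simp [snocFun]

theorem snocFun_last {α : Type*} {m : ℕ} (g : Fin m → α) (x : α) :
    snocFun (m + 1) g x (Fin.last m) = x := by
  simp [snocFun]

/-- A coordinate-formula bracket satisfies the chain rule in each slot. -/
theorem bracket_update_eq_sum_pderiv {k : Type*} [CommRing k] {n m : ℕ}
    (br : (Fin m → MvPolynomial (Fin n) k) → MvPolynomial (Fin n) k)
    (hcoord : ∀ g : Fin m → MvPolynomial (Fin n) k,
      br g = ∑ idx : Fin m → Fin n,
        br (fun j => MvPolynomial.X (idx j)) *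
          ∏ j : Fin m, MvPolynomial.pderiv (idx j) (g j))
    (v : Fin m → MvPolynomial (Fin n) k) (i : Fin m) (P : MvPolynomial (Fin n) k) :
    br (Function.update v i P) =
      ∑ r : Fin n, MvPolynomial.pderiv r P * br (Function.update v i (MvPolynomial.X r)) := by
  have key : ∀ (idx : Fin m → Fin n) (Q : MvPolynomial (Fin n) k),
      ∏ j : Fin m, MvPolynomial.pderiv (idx j) (Function.update v i Q j) =
        MvPolynomial.pderiv (idx i) Q *
          ∏ j ∈ Finset.univ.erase i, MvPolynomial.pderiv (idx j) (v j) := by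
    intro idx Q
    rw [← Finset.mul_prod_erase _ _ (Finset.mem_univ i), Function.update_self]
    congr 1
    refine Finset.prod_congr rfl fun j hj => ?_
    rw [Function.update_of_ne (Finset.ne_of_mem_erase hj)]
  rw [hcoord]
  simp_rw [hcoord (Function.update v i (MvPolynomial.X _)), key, Finset.mul_sum]
  rw [Finset.sum_comm]
  refine Finset.sum_congr rfl fun idx _ => ?_
  rw [Finset.sum_eq_single (idx i)]
  · rw [MvPolynomial.pderiv_X_self]
    ring
  · intro r _ hr
    rw [MvPolynomial.pderiv_X_of_ne hr]
    ring
  · simp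

/-- Expansion of a Hamiltonian vector field on a combination `∑ c ν * f ν`. -/
theorem IsNambuPoisson.bracket_sum_mul {k A ι : Type*} [CommRing k] [CommRing A] [Algebra k A]
    {m : ℕ} {br : (Fin (m + 1) → A) → A} (hbr : IsNambuPoisson k (m + 1) br)
    (g : Fin m → A) (s : Finset ι) (c f : ι → A) :
    br (snocFun (m + 1) g (∑ ν ∈ s, c ν * f ν)) =
      ∑ ν ∈ s, (c ν * br (snocFun (m + 1) g (f ν)) + br (snocFun (m + 1) g (c ν)) * f ν) := by
  have hlin := hbr.multilinear (snocFun (m + 1) g 0) (Fin.last m)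
  simp only [update_snocFun_last] at hlin
  have hsum := map_sum hlin.mk' (fun ν => c ν * f ν) s
  simp only [IsLinearMap.mk'_apply] at hsum
  rw [hsum]
  refine Finset.sum_congr rfl fun ν _ => ?_
  rw [hbr.leibniz, mul_comm (f ν)]

/-- flatness of the Nambu connection on the conormal module,
Maurer–Cartan equation modulo `I²`: for an even-arity Nambu-Poisson bracket on
`S = k[x₁,…,xₙ]` given by the coordinate formula, a Nambu-Poisson ideal
`I = (f₁,…,f_p)` and chosen coefficients `Z` with
`{x_{i₁},…,x_{i_{m-1}}, f_μ} = Σ_ν Z^ν_{i₁…i_{m-1} μ} f_ν`, the curvature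
expression applied to `f_μ` lies in `I²`. -/
theorem nambu_connection_flat
    (k : Type*) [Field k] [CharZero k] (n m p : ℕ) (hm : 2 ≤ m) (hme : Even m)
    (br : (Fin m → MvPolynomial (Fin n) k) → MvPolynomial (Fin n) k)
    (hbr : IsNambuPoisson k m br)
    (hcoord : ∀ g : Fin m → MvPolynomial (Fin n) k,
      br g = ∑ idx : Fin m → Fin n,
        br (fun j => MvPolynomial.X (idx j)) *
          ∏ j : Fin m, MvPolynomial.pderiv (idx j) (g j))
    (f : Fin p → MvPolynomial (Fin n) k)
    (hI : ∀ (g : Fin (m - 1) → MvPolynomial (Fin n) k),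
      ∀ h ∈ Ideal.span (Set.range f),
        br (snocFun m g h) ∈ Ideal.span (Set.range f))
    (Z : (Fin (m - 1) → Fin n) → Fin p → Fin p → MvPolynomial (Fin n) k)
    (hZ : ∀ (idx : Fin (m - 1) → Fin n) (μ : Fin p),
      br (snocFun m (fun s => MvPolynomial.X (idx s)) (f μ)) =
        ∑ ν : Fin p, Z idx μ ν * f ν)
    (a b : Fin (m - 1) → Fin n) (μ : Fin p) :
    (∑ ν : Fin p,
        (br (snocFun m (fun s => MvPolynomial.X (a s)) (Z b μ ν)) -
            br (snocFun m (fun s => MvPolynomial.X (b s)) (Z a μ ν)) +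
          ∑ lam : Fin p,
            (Z b μ lam * Z a lam ν - Z a μ lam * Z b lam ν) -
          ∑ r : Fin n, ∑ l : Fin (m - 1),
            MvPolynomial.pderiv r (br (fun j => MvPolynomial.X (snocFun m a (b l) j))) *
              Z (Function.update b l r) μ ν) *
          f ν) ∈ (Ideal.span (Set.range f)) ^ 2 := by
  obtain ⟨m, rfl⟩ : ∃ m', m = m' + 1 := ⟨m - 1, by omega⟩
  change Fin m → Fin n at a b
  have hcomp : ∀ a b : Fin m → Fin n,
      br (snocFun (m + 1) (fun s => MvPolynomial.X (a s))
        (br (snocFun (m + 1) (fun s => MvPolynomial.X (b s)) (f μ)))) =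
      ∑ ν, (br (snocFun (m + 1) (fun s => MvPolynomial.X (a s)) (Z b μ ν)) +
        ∑ lam, Z b μ lam * Z a lam ν) * f ν := by
    intro a b
    rw [hZ, hbr.bracket_sum_mul, Finset.sum_add_distrib]
    simp_rw [hZ, add_mul, Finset.sum_add_distrib, Finset.mul_sum, Finset.sum_mul]
    rw [add_comm, Finset.sum_comm]
    simp_rw [mul_assoc]
  have hslot : ∀ l : Fin m,
      br (Function.update (snocFun (m + 1) (fun s => MvPolynomial.X (b s)) (f μ)) l.castSucc
        (br (snocFun (m + 1) (fun s => MvPolynomial.X (a s)) (MvPolynomial.X (b l))))) =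
      ∑ ν, (∑ r, MvPolynomial.pderiv r
        (br (fun j => MvPolynomial.X (snocFun (m + 1) a (b l) j))) *
          Z (Function.update b l r) μ ν) * f ν := by
    intro l
    have hX : ∀ r : Fin n,
        br (Function.update (snocFun (m + 1) (fun s => MvPolynomial.X (b s)) (f μ)) l.castSucc
          (MvPolynomial.X r)) = ∑ ν, Z (Function.update b l r) μ ν * f ν := by
      intro r
      rw [update_snocFun_castSucc, ← hZ]
      exact congrArg (fun g => br (snocFun (m + 1) g (f μ)))
        (Function.comp_update MvPolynomial.X b l r).symm
    rw [bracket_update_eq_sum_pderiv br hcoord, comp_snocFun]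
    simp_rw [hX, Finset.sum_mul, Finset.mul_sum, mul_assoc]
    exact Finset.sum_comm
  have hfund := hbr.fundamental (fun s => MvPolynomial.X (a s))
    (snocFun (m + 1) (fun s => MvPolynomial.X (b s)) (f μ))
  rw [Fin.sum_univ_castSucc] at hfund
  simp only [snocFun_last, snocFun_castSucc, update_snocFun_last] at hfund
  rw [Finset.sum_congr rfl fun l _ => hslot l, hcomp a b, hcomp b a, Finset.sum_comm,
    ← Finset.sum_add_distrib, ← sub_eq_zero, ← Finset.sum_sub_distrib] at hfund
  convert Ideal.zero_mem _ using 1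
  rw [← hfund]
  refine Finset.sum_congr rfl fun ν _ => ?_
  rw [Finset.sum_sub_distrib, Finset.sum_comm (s := (Finset.univ : Finset (Fin n))),
    ← Finset.sum_mul]
  change (_ - _ + _ - ∑ l : Fin m, _) * _ = _
  ring
end
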